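/- For partitions μ, ν ⊆ λ, the Littlewood-Richardson coefficient satisfies c(λ'; μ', ν') = c(λ; μ, ν), where λ' denotes the conjugate (transpose) partition. -/

import Mathlib

open YoungDiagram
open scoped Classical

namespace LRSkew

/-- The cells of the skew diagram `lam/mu`. -/
def skewCells (lam mu : YoungDiagram) : Finset (ℕ × ℕ) := lam.cells \ mu.cells

/-- A semistandard filling of the skew shape `lam/mu`: entries are positive exactly on the
cells of the shape, rows are weakly increasing and columns are strictly increasing. -/
def IsSSYT (lam mu : YoungDiagram) (T : ℕ × ℕ → ℕ) : Prop :=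
  (∀ p, p ∈ skewCells lam mu ↔ T p ≠ 0) ∧
  (∀ i j1 j2, (i, j1) ∈ skewCells lam mu → (i, j2) ∈ skewCells lam mu → j1 ≤ j2 →
    T (i, j1) ≤ T (i, j2)) ∧
  (∀ i1 i2 j, (i1, j) ∈ skewCells lam mu → (i2, j) ∈ skewCells lam mu → i1 < i2 →
    T (i1, j) < T (i2, j))

/-- The number of entries equal to `k` among the cells read (in the reverse reading word:
right to left along rows, top row first) up to position `(i,j)`. -/
def prefixCount (lam mu : YoungDiagram) (T : ℕ × ℕ → ℕ) (i j k : ℕ) : ℕ :=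
  ((skewCells lam mu).filter fun p => (p.1 < i ∨ (p.1 = i ∧ j ≤ p.2)) ∧ T p = k).card

/-- The reverse reading word of the filling is a lattice word. -/
def IsLattice (lam mu : YoungDiagram) (T : ℕ × ℕ → ℕ) : Prop :=
  ∀ i j k, prefixCount lam mu T i j (k + 2) ≤ prefixCount lam mu T i j (k + 1)

/-- The number of entries of the filling equal to `k`. -/
def content (lam mu : YoungDiagram) (T : ℕ × ℕ → ℕ) (k : ℕ) : ℕ :=
  ((skewCells lam mu).filter fun p => T p = k).card

/-- A Littlewood–Richardson tableau of shape `lam/mu` and content `nu`. -/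
def IsLR (lam mu nu : YoungDiagram) (T : ℕ × ℕ → ℕ) : Prop :=
  IsSSYT lam mu T ∧ IsLattice lam mu T ∧ ∀ i, content lam mu T (i + 1) = nu.rowLen i

/-- The Littlewood–Richardson coefficient `c(lam; mu, nu)`. -/
noncomputable def lrCoeff (lam mu nu : YoungDiagram) : ℕ :=
  if mu ≤ lam then {T : ℕ × ℕ → ℕ | IsLR lam mu nu T}.ncard else 0

/-- Equality of the skew Schur functions `s_{lam/mu} = s_{alp/bet}`, expressed through
their expansions into Schur functions. -/
def SchurEq (lam mu alp bet : YoungDiagram) : Prop :=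
  ∀ nu : YoungDiagram, lrCoeff lam mu nu = lrCoeff alp bet nu

/-- The rectangular Young diagram `(k^l)` with `l` rows of length `k`. -/
def rect (k l : ℕ) : YoungDiagram :=
  ⟨Finset.range l ×ˢ Finset.range k, by
    intro a b hba ha
    simp only [Finset.coe_product, Set.mem_prod, Finset.mem_coe, Finset.mem_range] at ha ⊢
    exact ⟨lt_of_le_of_lt hba.1 ha.1, lt_of_le_of_lt hba.2 ha.2⟩⟩

/-- The complement of `nu` in the rectangle `(k^l)`, rotated by 180 degrees so that it is
again a partition: its parts are `(k - nu_l, …, k - nu_1)`. -/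
def complRect (k l : ℕ) (nu : YoungDiagram) : YoungDiagram :=
  ⟨(rect k l).cells.filter fun p => (l - 1 - p.1, k - 1 - p.2) ∉ nu, by
    intro a b hba ha
    simp only [Finset.coe_filter, Set.mem_setOf_eq, mem_cells] at ha ⊢
    refine ⟨(rect k l).isLowerSet hba ha.1, fun hmem => ha.2 ?_⟩
    exact nu.isLowerSet
      (Prod.mk_le_mk.mpr ⟨Nat.sub_le_sub_left hba.1 _, Nat.sub_le_sub_left hba.2 _⟩) hmem⟩

/-- The staircase partition `(n, n-1, …, 2, 1)`. -/
def staircase (n : ℕ) : YoungDiagram :=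
  ⟨(Finset.range n ×ˢ Finset.range n).filter fun p => p.1 + p.2 < n, by
    intro a b hba ha
    simp only [Finset.coe_filter, Set.mem_setOf_eq, Finset.mem_product, Finset.mem_range] at ha ⊢
    exact ⟨⟨lt_of_le_of_lt hba.1 ha.1.1, lt_of_le_of_lt hba.2 ha.1.2⟩,
      lt_of_le_of_lt (Nat.add_le_add hba.1 hba.2) ha.2⟩⟩

/-- A basic skew diagram: no empty rows and no empty columns. -/
def IsBasic (lam mu : YoungDiagram) : Prop :=
  (∀ i, i < lam.colLen 0 → mu.rowLen i < lam.rowLen i) ∧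
  (∀ j, j < lam.rowLen 0 → mu.colLen j < lam.colLen j)

/-- A (basic) skew diagram is connected iff consecutive rows share a column. -/
def IsConnectedSkew (lam mu : YoungDiagram) : Prop :=
  ∀ i, i + 1 < lam.colLen 0 → mu.rowLen i < lam.rowLen (i + 1)

/-- The number of distinct (positive) part sizes of a partition. -/
def dp (lam : YoungDiagram) : ℕ :=
  ((Finset.range (lam.colLen 0)).image fun i => lam.rowLen i).card

/-- A partition is a rectangle: all its parts are equal. -/
def IsRect (mu : YoungDiagram) : Prop :=
  ∀ i, i < mu.colLen 0 → mu.rowLen i = mu.rowLen 0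

/-- Cells of a skew diagram in the same connected component: the reflexive–transitive
closure of sharing a row or a column. -/
def SameComp (s : Finset (ℕ × ℕ)) : ℕ × ℕ → ℕ × ℕ → Prop :=
  Relation.ReflTransGen fun a b => a ∈ s ∧ b ∈ s ∧ (a.1 = b.1 ∨ a.2 = b.2)

/-- Two finite sets of boxes agree up to translation or 180°-rotation of each connected
component independently. -/
def UpToTransRot (s t : Finset (ℕ × ℕ)) : Prop :=
  ∃ f : ℕ × ℕ → ℕ × ℕ, Set.BijOn f ↑s ↑t ∧
    ∀ p ∈ s, ∀ q ∈ s, SameComp s p q →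
      (((f q).1 : ℤ) - (f p).1 = (q.1 : ℤ) - p.1 ∧ ((f q).2 : ℤ) - (f p).2 = (q.2 : ℤ) - p.2) ∨
      (((f q).1 : ℤ) - (f p).1 = (p.1 : ℤ) - q.1 ∧ ((f q).2 : ℤ) - (f p).2 = (p.2 : ℤ) - q.2)


set_option linter.unusedSectionVars false
/-! ### Abstract skew shapes -/

/-- number of elements satisfying a predicate -/
noncomputable def cnt {X : Type} [Fintype X] (P : X → Prop) : ℕ := (Finset.univ.filter P).card

section counting
variable {X : Type} [Fintype X]

lemma cnt_congr {P Q : X → Prop} (h : ∀ x, P x ↔ Q x) : cnt P = cnt Q := by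
  have : P = Q := funext fun x => propext (h x)
  rw [this]

lemma cnt_mono {P Q : X → Prop} (h : ∀ x, P x → Q x) : cnt P ≤ cnt Q :=
  Finset.card_le_card fun x hx => by
    simp only [Finset.mem_filter, Finset.mem_univ, true_and] at hx ⊢
    exact h x hx

lemma cnt_lt {P Q : X → Prop} (h : ∀ x, P x → Q x) (z : X) (hz : Q z) (hz' : ¬ P z) :
    cnt P < cnt Q := by
  apply Finset.card_lt_card
  rw [Finset.ssubset_iff_of_subset]
  · exact ⟨z, by simpa using hz, by simpa using hz'⟩
  · intro x hx
    simp only [Finset.mem_filter, Finset.mem_univ, true_and] at hx ⊢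
    exact h x hx

lemma cnt_le_rel {P Q : X → Prop} (g : X → X) (h : ∀ x, P x → Q (g x))
    (hinj : ∀ x y, P x → P y → g x = g y → x = y) : cnt P ≤ cnt Q := by
  apply Finset.card_le_card_of_injOn g
  · intro x hx
    simp only [Finset.coe_filter, Finset.mem_univ, true_and, Set.mem_ofPred_eq] at hx ⊢
    exact h x hx
  · intro x hx y hy hxy
    simp only [Finset.coe_filter, Finset.mem_univ, true_and, Set.mem_ofPred_eq] at hx hy
    exact hinj x y hx hy hxy

lemma cnt_le_exists {P Q : X → Prop} (R : X → X → Prop) (h : ∀ x, P x → ∃ z, Q z ∧ R x z)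
    (hinj : ∀ x y z, P x → P y → R x z → R y z → x = y) : cnt P ≤ cnt Q := by
  classical
  refine cnt_le_rel (fun x => if hx : P x then (h x hx).choose else x) ?_ ?_
  · intro x hx
    simp only [hx, dif_pos]
    exact (h x hx).choose_spec.1
  · intro x y hx hy hxy
    simp only [hx, hy, dif_pos] at hxy
    have h1 := (h x hx).choose_spec.2
    have h2 := (h y hy).choose_spec.2
    rw [hxy] at h1
    exact hinj x y _ hx hy h1 h2

lemma cnt_split (P Q : X → Prop) : cnt P = cnt (fun x => P x ∧ Q x) + cnt (fun x => P x ∧ ¬ Q x) := by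
  unfold cnt
  rw [← Finset.card_filter_add_card_filter_not (s := Finset.univ.filter P) Q, Finset.filter_filter,
    Finset.filter_filter]
  congr!

lemma cnt_eq_zero {P : X → Prop} (h : ∀ x, ¬ P x) : cnt P = 0 := by
  unfold cnt; simp [h]

lemma exists_of_cnt_lt {P Q : X → Prop} (h : cnt P < cnt Q) : ∃ x, Q x ∧ ¬ P x := by
  by_contra hc
  push Not at hc
  exact absurd (cnt_mono hc) (by omega)

lemma exists_of_cnt_pos {P : X → Prop} (h : 0 < cnt P) : ∃ x, P x := by
  by_contra hc
  push Not at hc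
  rw [cnt_eq_zero hc] at h
  omega

lemma cnt_le_one {P : X → Prop} (h : ∀ x y, P x → P y → x = y) : cnt P ≤ 1 := by
  apply Finset.card_le_one.2
  intro a ha b hb
  simp only [Finset.mem_filter, Finset.mem_univ, true_and] at ha hb
  exact h a b ha hb

lemma exists_min_of {P : X → Prop} (c : X → ℤ) (h : ∃ x, P x) :
    ∃ x, P x ∧ ∀ y, P y → c x ≤ c y := by
  obtain ⟨x0, h0⟩ := h
  obtain ⟨x, hx, hm⟩ := Finset.exists_min_image (Finset.univ.filter P) c ⟨x0, by simpa using h0⟩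
  exact ⟨x, by simpa using hx, fun y hy => hm y (by simpa using hy)⟩

end counting

/-- An abstract skew shape, with row and column coordinates. -/
structure Skew {X : Type} (r c : X → ℤ) : Prop where
  inj : ∀ x y, r x = r y → c x = c y → x = y
  corner₁ : ∀ x y, r x ≤ r y → c x ≤ c y → ∃ z, r z = r x ∧ c z = c y
  corner₂ : ∀ x y, r x ≤ r y → c x ≤ c y → ∃ z, r z = r y ∧ c z = c x

/-- Semistandard fillings of an abstract skew shape. -/
structure SST {X : Type} (r c : X → ℤ) {n : ℕ} (T : X → Fin n) : Prop where
  row : ∀ x y, r x = r y → c x ≤ c y → T x ≤ T y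
  col : ∀ x y, c x = c y → r x < r y → T x < T y

/-- column lattice condition -/
def Good {X : Type} [Fintype X] (c : X → ℤ) {n : ℕ} (T : X → Fin n) : Prop :=
  ∀ (j : ℤ) (k l : Fin n), (l : ℕ) = k + 1 →
    cnt (fun x => T x = l ∧ j ≤ c x) ≤ cnt (fun x => T x = k ∧ j ≤ c x)

/-- row lattice condition -/
def RowGood {X : Type} [Fintype X] (r c : X → ℤ) {n : ℕ} (T : X → Fin n) : Prop :=
  ∀ (i j : ℤ) (k l : Fin n), (l : ℕ) = k + 1 →
    cnt (fun x => T x = l ∧ (r x < i ∨ (r x = i ∧ j ≤ c x))) ≤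
    cnt (fun x => T x = k ∧ (r x < i ∨ (r x = i ∧ j ≤ c x)))

section basic
variable {X : Type} [Fintype X] {r c : X → ℤ} {n : ℕ} {T : X → Fin n}

lemma SST.mono (hT : SST r c T) (hX : Skew r c) {x y : X} (h1 : r x ≤ r y) (h2 : c x ≤ c y) :
    T x ≤ T y := by
  obtain ⟨z, hz1, hz2⟩ := hX.corner₁ x y h1 h2
  have h3 := hT.row x z hz1.symm (by omega)
  rcases eq_or_lt_of_le h1 with h | h
  · exact hT.row x y h h2
  · exact h3.trans (hT.col z y hz2 (by omega)).le

lemma SST.smono (hT : SST r c T) (hX : Skew r c) {x y : X} (h1 : r x < r y) (h2 : c x ≤ c y) :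
    T x < T y := by
  obtain ⟨z, hz1, hz2⟩ := hX.corner₁ x y h1.le h2
  have h3 := hT.row x z hz1.symm (by omega)
  exact h3.trans_lt (hT.col z y hz2 (by omega))

lemma SST.eq_of_col (hT : SST r c T) (hX : Skew r c) {x y : X} (h1 : T x = T y) (h2 : c x = c y) :
    x = y := by
  rcases lt_trichotomy (r x) (r y) with h | h | h
  · exact absurd h1 (hT.col x y h2 h).ne
  · exact hX.inj x y h h2
  · exact absurd h1 (hT.col y x h2.symm h).ne'

lemma good_of_rowGood (hX : Skew r c) (hT : SST r c T) (h : RowGood r c T) : Good c T := by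
  intro j k l hkl
  have key : ∀ x, T x = l →
      cnt (fun y => T y = l ∧ c x ≤ c y) ≤ cnt (fun y => T y = k ∧ c x ≤ c y) := by
    by_contra hc
    push Not at hc
    obtain ⟨x, ⟨hxl, hx⟩, hmin⟩ := exists_min_of (P := fun x => T x = l ∧
      cnt (fun y => T y = k ∧ c x ≤ c y) < cnt (fun y => T y = l ∧ c x ≤ c y)) c hc
    have h1 := h (r x) (c x) k l hkl
    have h2 : cnt (fun y => T y = l ∧ c x ≤ c y) ≤
        cnt (fun y => T y = l ∧ (r y < r x ∨ (r y = r x ∧ c x ≤ c y))) := by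
      apply cnt_mono
      rintro y ⟨hy, hcy⟩
      refine ⟨hy, ?_⟩
      rcases lt_trichotomy (r y) (r x) with h' | h' | h'
      · exact Or.inl h'
      · exact Or.inr ⟨h', hcy⟩
      · exact absurd (hT.smono hX h' hcy) (by rw [hxl, hy]; exact lt_irrefl _)
    obtain ⟨w, ⟨hwk, hwR⟩, hw⟩ := exists_of_cnt_lt (hx.trans_le (h2.trans h1))
    have hcw : c w < c x := by
      by_contra hcw
      exact hw ⟨hwk, by omega⟩
    have hrw : r w < r x := by
      rcases hwR with h' | h'
      · exact h'
      · omega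
    obtain ⟨x0, hx01, hx02⟩ := hX.corner₂ w x hrw.le hcw.le
    have hx0l : T x0 = l := by
      have a1 := hT.col w x0 hx02.symm (by omega)
      have a2 := hT.row x0 x hx01 (by omega)
      apply le_antisymm
      · rw [← hxl]; exact a2
      · rw [hwk, Fin.lt_def] at a1
        rw [Fin.le_def]; omega
    have h3 : cnt (fun y => T y = l ∧ c x0 ≤ c y) ≤ cnt (fun y => T y = k ∧ c x0 ≤ c y) := by
      by_contra h3
      have := hmin x0 ⟨hx0l, by omega⟩
      omega
    rw [cnt_split (fun y => T y = l ∧ c x0 ≤ c y) (fun y => c x ≤ c y),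
      cnt_split (fun y => T y = k ∧ c x0 ≤ c y) (fun y => c x ≤ c y)] at h3
    have e1 : cnt (fun y => (T y = l ∧ c x0 ≤ c y) ∧ c x ≤ c y) = cnt (fun y => T y = l ∧ c x ≤ c y) :=
      cnt_congr fun y => ⟨fun h => ⟨h.1.1, h.2⟩, fun h => ⟨⟨h.1, by omega⟩, h.2⟩⟩
    have e2 : cnt (fun y => (T y = k ∧ c x0 ≤ c y) ∧ c x ≤ c y) = cnt (fun y => T y = k ∧ c x ≤ c y) :=
      cnt_congr fun y => ⟨fun h => ⟨h.1.1, h.2⟩, fun h => ⟨⟨h.1, by omega⟩, h.2⟩⟩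
    have e3 : cnt (fun y => (T y = k ∧ c x0 ≤ c y) ∧ ¬ c x ≤ c y) ≤
        cnt (fun y => (T y = l ∧ c x0 ≤ c y) ∧ ¬ c x ≤ c y) := by
      apply cnt_le_exists (fun y z => c y = c z)
      · rintro y ⟨⟨hy, hy1⟩, hy2⟩
        have hry : r y ≤ r x := by
          by_contra hry
          have := hT.mono hX (x := x0) (y := y) (by omega) hy1
          rw [hx0l, hy, Fin.le_def] at this
          omega
        have hry' : r y ≠ r x := by
          intro hry'
          have := hT.mono hX (x := x0) (y := y) (by omega) hy1
          rw [hx0l, hy, Fin.le_def] at this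
          omega
        obtain ⟨z, hz1, hz2⟩ := hX.corner₂ y x hry (by omega)
        refine ⟨z, ⟨⟨?_, by omega⟩, by omega⟩, hz2.symm⟩
        have a1 := hT.col y z hz2.symm (by omega)
        have a2 := hT.row z x hz1 (by omega)
        apply le_antisymm
        · rw [← hxl]; exact a2
        · rw [hy, Fin.lt_def] at a1
          rw [Fin.le_def]; omega
      · rintro y y' z ⟨⟨hy, _⟩, _⟩ ⟨⟨hy', _⟩, _⟩ h1 h2
        exact hT.eq_of_col hX (hy.trans hy'.symm) (h1.trans h2.symm)
    omega
  by_cases hex : ∃ x, T x = l ∧ j ≤ c x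
  · obtain ⟨x, ⟨hx, hjx⟩, hmin⟩ := exists_min_of c hex
    calc cnt (fun x => T x = l ∧ j ≤ c x) ≤ cnt (fun y => T y = l ∧ c x ≤ c y) :=
          cnt_mono fun y hy => ⟨hy.1, hmin y hy⟩
      _ ≤ cnt (fun y => T y = k ∧ c x ≤ c y) := key x hx
      _ ≤ _ := cnt_mono fun y hy => ⟨hy.1, hjx.trans hy.2⟩
  · push Not at hex
    rw [cnt_eq_zero (fun x hx => absurd (hex x hx.1) (not_lt.2 hx.2))]
    exact Nat.zero_le _

lemma rowGood_of_good (hX : Skew r c) (hT : SST r c T) (h : Good c T) : RowGood r c T := by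
  intro i j k l hkl
  by_cases hex : ∃ x, T x = l ∧ (r x < i ∨ (r x = i ∧ j ≤ c x))
  · obtain ⟨x, ⟨hx, hR⟩, hmin⟩ := exists_min_of c hex
    calc cnt (fun x => T x = l ∧ (r x < i ∨ (r x = i ∧ j ≤ c x)))
        ≤ cnt (fun y => T y = l ∧ c x ≤ c y) := cnt_mono fun y hy => ⟨hy.1, hmin y hy⟩
      _ ≤ cnt (fun y => T y = k ∧ c x ≤ c y) := h _ k l hkl
      _ ≤ _ := by
        apply cnt_mono
        rintro z ⟨hz, hcz⟩
        refine ⟨hz, Or.inl ?_⟩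
        by_contra hri
        have := hT.mono hX (x := x) (y := z) (by omega) hcz
        rw [hx, hz, Fin.le_def] at this
        omega
  · push Not at hex
    rw [cnt_eq_zero]
    · exact Nat.zero_le _
    · rintro x ⟨hx, hR⟩
      have := hex x hx
      omega

end basic

/-! ### Pictures -/

/-- Pictures from an abstract skew shape to a Young diagram. -/
structure Pic {X : Type} (r c : X → ℤ) (nu : YoungDiagram) (f : X → ℕ × ℕ) : Prop where
  inj : ∀ x y, f x = f y → x = y
  range : ∀ p, p ∈ nu ↔ ∃ x, f x = p
  p1 : ∀ x y, r x ≤ r y → c x ≤ c y → (f x).1 ≤ (f y).1 ∧ (f y).2 ≤ (f x).2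
  p2 : ∀ x y, (f x).1 ≤ (f y).1 → (f x).2 ≤ (f y).2 → r x ≤ r y ∧ c y ≤ c x

/-- good semistandard fillings of content nu -/
structure GoodSST {X : Type} [Fintype X] (r c : X → ℤ) {n : ℕ} (nu : Fin n → ℕ) (T : X → Fin n) :
    Prop where
  sst : SST r c T
  good : Good c T
  cont : ∀ a, cnt (fun x => T x = a) = nu a

lemma Pic.dual {X : Type} {r c : X → ℤ} {nu : YoungDiagram} {f : X → ℕ × ℕ} (h : Pic r c nu f) :
    Pic (fun x => - c x) (fun x => - r x) nu.transpose (fun x => (f x).swap) where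
  inj x y hxy := h.inj x y (Prod.swap_injective hxy)
  range p := by
    rw [YoungDiagram.mem_transpose, h.range]
    constructor
    · rintro ⟨x, hx⟩; exact ⟨x, by rw [hx, Prod.swap_swap]⟩
    · rintro ⟨x, hx⟩; exact ⟨x, by rw [← hx, Prod.swap_swap]⟩
  p1 x y h1 h2 := by
    have := h.p1 y x (by omega) (by omega)
    exact ⟨this.2, this.1⟩
  p2 x y h1 h2 := by
    have := h.p2 x y h2 h1
    omega

lemma pic_dual_ncard {X : Type} (r c : X → ℤ) (nu : YoungDiagram) :
    {f | Pic r c nu f}.ncard =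
      {f | Pic (fun x => - c x) (fun x => - r x) nu.transpose f}.ncard := by
  refine Set.ncard_congr (fun f _ => fun x => (f x).swap) (fun f hf => Pic.dual hf) ?_ ?_
  · intro f g _ _ h
    funext x
    exact Prod.swap_injective (congrFun h x)
  · intro g hg
    refine ⟨fun x => (g x).swap, ?_, ?_⟩
    · have := Pic.dual hg
      simpa using this
    · funext x; simp

section pictures
variable {X : Type} [Fintype X] {r c : X → ℤ} {n : ℕ} {T : X → Fin n}

/-- index of a cell among those with the same entry -/
noncomputable def idx (c : X → ℤ) (T : X → Fin n) (x : X) : ℕ :=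
  cnt (fun y => T y = T x ∧ c x < c y)

lemma idx_lt {x y : X} (h : T x = T y) (hc : c x < c y) : idx c T y < idx c T x := by
  apply cnt_lt (z := y)
  · rintro z ⟨h1, h2⟩; exact ⟨h1.trans h.symm, by omega⟩
  · exact ⟨h.symm, hc⟩
  · rintro ⟨_, h2⟩; omega

lemma idx_le {x y : X} (h : T x = T y) (hc : c x ≤ c y) : idx c T y ≤ idx c T x := by
  apply cnt_mono
  rintro z ⟨h1, h2⟩; exact ⟨h1.trans h.symm, by omega⟩

variable {nu : YoungDiagram}

lemma idx_exists (hX : Skew r c) (hT : GoodSST r c (fun a : Fin n => nu.rowLen a) T) (a : Fin n)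
    (m : ℕ) (hm : m < nu.rowLen a) : ∃ x, T x = a ∧ idx c T x = m := by
  have hc := hT.cont a
  have := Finset.surj_on_of_inj_on_of_card_le (s := Finset.univ.filter fun x => T x = a)
    (t := Finset.range (nu.rowLen a)) (fun x _ => idx c T x) ?_ ?_ ?_ m (by simpa using hm)
  · obtain ⟨x, hx, hxm⟩ := this
    exact ⟨x, by simpa using hx, hxm.symm⟩
  · intro x hx
    simp only [Finset.mem_filter, Finset.mem_univ, true_and] at hx
    rw [Finset.mem_range, ← hc]
    exact cnt_lt (fun y hy => hy.1.trans hx) x hx (fun h => absurd h.2 (lt_irrefl _))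
  · intro x y hx hy hxy
    simp only [Finset.mem_filter, Finset.mem_univ, true_and] at hx hy
    have hT' : T x = T y := hx.trans hy.symm
    apply hT.sst.eq_of_col hX hT'
    rcases lt_trichotomy (c x) (c y) with h | h | h
    · exact absurd hxy (idx_lt hT' h).ne'
    · exact h
    · exact absurd hxy (idx_lt hT'.symm h).ne
  · rw [Finset.card_range]
    refine hc.ge.trans (le_of_eq ?_)
    unfold cnt
    congr!

lemma idx_step (hT : GoodSST r c (fun a : Fin n => nu.rowLen a) T) {x z : X}
    (h : (T x : ℕ) = T z + 1) (hm : idx c T z = idx c T x) : c x ≤ c z := by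
  by_contra hcon
  have h1 := hT.good (c x) _ _ h
  have h2 : cnt (fun y => T y = T x ∧ c x < c y) < cnt (fun y => T y = T x ∧ c x ≤ c y) :=
    cnt_lt (fun y hy => ⟨hy.1, hy.2.le⟩) x ⟨rfl, le_rfl⟩ (fun h => absurd h.2 (lt_irrefl (c x)))
  have h3 : cnt (fun y => T y = T z ∧ c x ≤ c y) ≤ idx c T z :=
    cnt_mono fun y hy => ⟨hy.1, by omega⟩
  change idx c T x < _ at h2
  omega

lemma idx_chain (hX : Skew r c) (hT : GoodSST r c (fun a : Fin n => nu.rowLen a) T) (d : ℕ) :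
    ∀ (x : X) (b : Fin n), (T x : ℕ) = b + d → ∃ z, T z = b ∧ idx c T z = idx c T x ∧ c x ≤ c z := by
  induction d with
  | zero =>
    intro x b h
    exact ⟨x, Fin.ext (by omega), rfl, le_rfl⟩
  | succ d ih =>
    intro x b h
    have hlt : idx c T x < nu.rowLen (T x) := by
      have := hT.cont (T x)
      rw [← this]
      exact cnt_lt (fun y hy => hy.1) x rfl (fun h => absurd h.2 (lt_irrefl _))
    have hb : (b : ℕ) + d < n := by have := (T x).2; omega
    obtain ⟨z, hz, hz'⟩ := idx_exists hX hT ⟨b + d, hb⟩ (idx c T x)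
      (hlt.trans_le (nu.rowLen_anti _ _ (by simp only; omega)))
    have h1 := idx_step hT (x := x) (z := z) (by rw [hz]; simp only; omega) hz'
    obtain ⟨w, hw1, hw2, hw3⟩ := ih z b (by rw [hz])
    exact ⟨w, hw1, hw2.trans hz', h1.trans hw3⟩

lemma pic_of_good (hX : Skew r c) (hn : nu.colLen 0 ≤ n)
    (hT : GoodSST r c (fun a : Fin n => nu.rowLen a) T) :
    Pic r c nu (fun x => ((T x : ℕ), idx c T x)) where
  inj x y hxy := by
    simp only [Prod.mk.injEq] at hxy
    have hT' : T x = T y := Fin.ext hxy.1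
    apply hT.sst.eq_of_col hX hT'
    rcases lt_trichotomy (c x) (c y) with h | h | h
    · exact absurd hxy.2 (idx_lt hT' h).ne'
    · exact h
    · exact absurd hxy.2 (idx_lt hT'.symm h).ne
  range p := by
    obtain ⟨a, m⟩ := p
    rw [YoungDiagram.mem_iff_lt_rowLen]
    constructor
    · intro h
      have ha : a < n := by
        have h0 : (a, m) ∈ nu := YoungDiagram.mem_iff_lt_rowLen.2 h
        have h1 : (a, 0) ∈ nu := nu.up_left_mem le_rfl (Nat.zero_le _) h0
        exact (YoungDiagram.mem_iff_lt_colLen.1 h1).trans_le hn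
      obtain ⟨x, hx, hx'⟩ := idx_exists hX hT ⟨a, ha⟩ m h
      exact ⟨x, by rw [hx, hx']⟩
    · rintro ⟨x, hx⟩
      simp only [Prod.mk.injEq] at hx
      have := hT.cont (T x)
      rw [← hx.1, ← hx.2, ← this]
      exact cnt_lt (fun y hy => hy.1) x rfl (fun h => absurd h.2 (lt_irrefl _))
  p1 x y h1 h2 := by
    have h := hT.sst.mono hX h1 h2
    refine ⟨h, ?_⟩
    obtain ⟨z, hz1, hz2, hz3⟩ := idx_chain hX hT (T y - T x) y (T x) (by
      rw [Fin.le_def] at h; omega)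
    simp only
    rw [← hz2]
    exact idx_le hz1.symm (by omega)
  p2 x y h1 h2 := by
    simp only at h1 h2
    obtain ⟨z, hz1, hz2, hz3⟩ := idx_chain hX hT (T y - T x) y (T x) (by omega)
    have h3 : c z ≤ c x := by
      by_contra hc
      have := idx_lt (c := c) hz1.symm (not_le.1 hc)
      omega
    have h4 : c y ≤ c x := hz3.trans h3
    refine ⟨?_, h4⟩
    by_contra hr
    have := hT.sst.smono hX (not_le.1 hr) h4
    rw [Fin.lt_def] at this
    omega

lemma Pic.idx_iff {f : X → ℕ × ℕ} (hf : Pic r c nu f) (x y : X) (h : (f y).1 = (f x).1) :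
    c x < c y ↔ (f y).2 < (f x).2 := by
  constructor
  · intro hc
    by_contra h'
    have := hf.p2 x y h.ge (not_lt.1 h')
    omega
  · intro h'
    have h1 := hf.p2 y x h.le h'.le
    by_contra hc
    have := hf.p1 y x h1.1 (by omega)
    omega

lemma Pic.cnt_fst {f : X → ℕ × ℕ} (hf : Pic r c nu f) (a b : ℕ) (hb : b ≤ nu.rowLen a) :
    cnt (fun x => (f x).1 = a ∧ (f x).2 < b) = b := by
  conv_rhs => rw [← Finset.card_range b]
  apply Finset.card_nbij (fun x => (f x).2)
  · intro x hx
    simp only [Finset.mem_coe, Finset.mem_filter, Finset.mem_univ, true_and, Finset.mem_range] at hx ⊢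
    exact hx.2
  · intro x hx y hy hxy
    simp only [Finset.coe_filter, Finset.mem_univ, true_and, Set.mem_ofPred_eq] at hx hy
    exact hf.inj x y (Prod.ext (hx.1.trans hy.1.symm) hxy)
  · intro m hm
    simp only [Finset.coe_range, Set.mem_Iio] at hm
    obtain ⟨x, hx⟩ := (hf.range (a, m)).1 (YoungDiagram.mem_iff_lt_rowLen.2 (by omega))
    refine ⟨x, ?_, by simp [hx]⟩
    simp [hx, hm]

lemma Pic.mem {f : X → ℕ × ℕ} (hf : Pic r c nu f) (x : X) : f x ∈ nu := (hf.range _).2 ⟨x, rfl⟩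

lemma good_of_pic {f : X → ℕ × ℕ} (hf : Pic r c nu f)
    (hT : ∀ x, (T x : ℕ) = (f x).1) : GoodSST r c (fun a : Fin n => nu.rowLen a) T where
  sst := by
    refine ⟨fun x y h1 h2 => ?_, fun x y h1 h2 => ?_⟩
    · rw [Fin.le_def, hT, hT]; exact (hf.p1 x y h1.le h2).1
    · rw [Fin.lt_def, hT, hT]
      have h3 := hf.p1 x y h2.le h1.le
      by_contra hc
      have := hf.p2 y x (by omega) h3.2
      omega
  good := by
    intro j k l hkl
    apply cnt_le_exists (fun x z => (f x).2 = (f z).2)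
    · rintro x ⟨hx, hj⟩
      have hfx : (f x).1 = k + 1 := by rw [← hT, hx, hkl]
      have hmem : ((k : ℕ), (f x).2) ∈ nu := nu.up_left_mem (by omega) le_rfl (hf.mem x)
      obtain ⟨z, hz⟩ := (hf.range _).1 hmem
      have h1 := hf.p2 z x (by rw [hz]; simp only; omega) (by rw [hz])
      refine ⟨z, ⟨Fin.ext (by rw [hT, hz]), by omega⟩, by rw [hz]⟩
    · rintro x y z ⟨hx, _⟩ ⟨hy, _⟩ h1 h2
      exact hf.inj x y (Prod.ext (by rw [← hT, ← hT, hx, hy]) (h1.trans h2.symm))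
  cont a := by
    rw [← hf.cnt_fst (a : ℕ) (nu.rowLen a) le_rfl]
    apply cnt_congr
    intro x
    constructor
    · rintro rfl
      refine ⟨(hT x).symm, ?_⟩
      rw [hT]; exact YoungDiagram.mem_iff_lt_rowLen.1 (hf.mem x)
    · rintro ⟨h, _⟩
      exact Fin.ext (by rw [hT, h])

lemma idx_of_pic {f : X → ℕ × ℕ} (hf : Pic r c nu f)
    (hT : ∀ x, (T x : ℕ) = (f x).1) (x : X) : idx c T x = (f x).2 := by
  rw [← hf.cnt_fst (f x).1 (f x).2 (YoungDiagram.mem_iff_lt_rowLen.1 (hf.mem x)).le]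
  apply cnt_congr
  intro y
  rw [Fin.ext_iff, hT, hT]
  constructor
  · rintro ⟨h1, h2⟩; exact ⟨h1, (hf.idx_iff x y h1).1 h2⟩
  · rintro ⟨h1, h2⟩; exact ⟨h1, (hf.idx_iff x y h1).2 h2⟩

lemma good_ncard_eq_pic (hX : Skew r c) (hn : nu.colLen 0 ≤ n) :
    {T : X → Fin n | GoodSST r c (fun a : Fin n => nu.rowLen a) T}.ncard =
      {f | Pic r c nu f}.ncard := by
  refine Set.ncard_congr (fun T _ => fun x => ((T x : ℕ), idx c T x))
    (fun T hT => pic_of_good hX hn hT) ?_ ?_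
  · intro T T' _ _ h
    funext x
    have := congrFun h x
    simp only [Prod.mk.injEq] at this
    exact Fin.ext this.1
  · intro f hf
    have hlt : ∀ x, (f x).1 < n := fun x => by
      have h1 : ((f x).1, 0) ∈ nu := nu.up_left_mem le_rfl (Nat.zero_le _) (hf.mem x)
      exact (YoungDiagram.mem_iff_lt_colLen.1 h1).trans_le hn
    refine ⟨fun x => ⟨(f x).1, hlt x⟩,
      good_of_pic (T := fun x => (⟨(f x).1, hlt x⟩ : Fin n)) hf (fun _ => rfl), ?_⟩
    funext x
    exact Prod.ext rfl (idx_of_pic (T := fun x => (⟨(f x).1, hlt x⟩ : Fin n)) hf (fun _ => rfl) x)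

end pictures
/-! ### Bender–Knuth involutions -/

lemma exists_rev (s : Finset ℤ) : ∃ ρ : ℤ → ℤ, (∀ a ∈ s, ρ a ∈ s ∧ ρ (ρ a) = a) ∧
    ∀ a ∈ s, ∀ b ∈ s, a < b → ρ b < ρ a := by
  classical
  let e := s.orderIsoOfFin rfl
  refine ⟨fun a => if h : a ∈ s then (e (Fin.rev (e.symm ⟨a, h⟩)) : ℤ) else a, ?_, ?_⟩
  · intro a ha
    simp only [ha, dif_pos]
    refine ⟨(e (Fin.rev (e.symm ⟨a, ha⟩))).2, ?_⟩
    rw [dif_pos (e (Fin.rev (e.symm ⟨a, ha⟩))).2]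
    simp
  · intro a ha b hb hab
    simp only [ha, hb, dif_pos]
    rw [Subtype.coe_lt_coe, e.lt_iff_lt, Fin.rev_lt_rev, e.symm.lt_iff_lt]
    exact hab

lemma exists_sigma {X : Type} [Fintype X] {r c : X → ℤ} (hX : Skew r c) (F : X → Prop) :
    ∃ σ : X → X, (∀ x, F x → F (σ x) ∧ r (σ x) = r x ∧ σ (σ x) = x) ∧
      ∀ x y, F x → F y → r x = r y → c x < c y → c (σ y) < c (σ x) := by
  classical
  have hs : ∀ i : ℤ, ∃ ρ : ℤ → ℤ, (∀ a, (∃ x, F x ∧ r x = i ∧ c x = a) →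
      (∃ x, F x ∧ r x = i ∧ c x = ρ a) ∧ ρ (ρ a) = a) ∧
      ∀ a b, (∃ x, F x ∧ r x = i ∧ c x = a) → (∃ x, F x ∧ r x = i ∧ c x = b) → a < b →
        ρ b < ρ a := by
    intro i
    obtain ⟨ρ, h1, h2⟩ := exists_rev ((Finset.univ.filter fun x => F x ∧ r x = i).image c)
    simp only [Finset.mem_image, Finset.mem_filter, Finset.mem_univ, true_and, and_assoc] at h1 h2
    exact ⟨ρ, h1, fun a b ha hb => h2 a ha b hb⟩
  choose ρ h1 h2 using hs
  have hx : ∀ x, ∃ y, F x → F y ∧ r y = r x ∧ c y = ρ (r x) (c x) := by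
    intro x
    by_cases hF : F x
    · obtain ⟨y, hy⟩ := (h1 (r x) (c x) ⟨x, hF, rfl, rfl⟩).1
      exact ⟨y, fun _ => hy⟩
    · exact ⟨x, fun h => absurd h hF⟩
  choose σ hσ using hx
  refine ⟨σ, fun x hF => ?_, fun x y hFx hFy hr hc => ?_⟩
  · obtain ⟨a1, a2, a3⟩ := hσ x hF
    obtain ⟨b1, b2, b3⟩ := hσ _ a1
    refine ⟨a1, a2, hX.inj _ _ (b2.trans a2) ?_⟩
    rw [b3, a2, a3]
    exact (h1 (r x) (c x) ⟨x, hF, rfl, rfl⟩).2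
  · rw [(hσ x hFx).2.2, (hσ y hFy).2.2, hr]
    exact h2 (r y) _ _ ⟨x, hFx, hr, rfl⟩ ⟨y, hFy, rfl, rfl⟩ hc

section BK
variable {X : Type} [Fintype X] {r c : X → ℤ} {n : ℕ}

/-- row-wise reversal of a set of cells -/
noncomputable def sig (hX : Skew r c) (F : X → Prop) : X → X := (exists_sigma hX F).choose

/-- cells left of column `j` that are free for the pair `k, l` -/
def Free (c : X → ℤ) (j : ℤ) (k l : Fin n) (T : X → Fin n) (x : X) : Prop :=
  c x < j ∧ (T x = k ∨ T x = l) ∧ ∀ y, c y = c x → (T y = k ∨ T y = l) → y = x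

/-- Bender–Knuth involution on columns left of `j` -/
noncomputable def bk (hX : Skew r c) (j : ℤ) (k l : Fin n) (T : X → Fin n) : X → Fin n := fun x =>
  if Free c j k l T x then Equiv.swap k l (T (sig hX (Free c j k l T) x)) else T x

variable (hX : Skew r c) (j : ℤ) (k l : Fin n) (T : X → Fin n)

lemma bk_of_not {x : X} (h : ¬ Free c j k l T x) : bk hX j k l T x = T x := if_neg h

lemma bk_of_free {x : X} (h : Free c j k l T x) :
    bk hX j k l T x = Equiv.swap k l (T (sig hX (Free c j k l T) x)) := if_pos h

lemma sig_spec {F : X → Prop} {x : X} (h : F x) : F (sig hX F x) ∧ r (sig hX F x) = r x ∧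
    sig hX F (sig hX F x) = x := (exists_sigma hX F).choose_spec.1 x h

lemma sig_anti {F : X → Prop} {x y : X} (h : F x) (h' : F y) (hr : r x = r y) (hc : c x < c y) :
    c (sig hX F y) < c (sig hX F x) := (exists_sigma hX F).choose_spec.2 x y h h' hr hc

lemma bk_free {x : X} (h : Free c j k l T x) :
    (T (sig hX (Free c j k l T) x) = k ∧ bk hX j k l T x = l) ∨
    (T (sig hX (Free c j k l T) x) = l ∧ bk hX j k l T x = k) := by
  have h1 := (sig_spec hX h).1.2.1
  unfold bk
  rw [if_pos h]
  rcases h1 with h1 | h1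
  · left; rw [h1]; simp
  · right; rw [h1]; simp

lemma bk_mem (x : X) : (bk hX j k l T x = k ∨ bk hX j k l T x = l) ↔ (T x = k ∨ T x = l) := by
  by_cases h : Free c j k l T x
  · have h1 := bk_free hX j k l T h
    have h2 := h.2.1
    tauto
  · rw [bk_of_not hX j k l T h]

lemma free_bk : Free c j k l (bk hX j k l T) = Free c j k l T := by
  funext x
  unfold Free
  simp only [bk_mem]

lemma bk_bk : bk hX j k l (bk hX j k l T) = T := by
  funext x
  by_cases h : Free c j k l T x
  · have h' : Free c j k l (bk hX j k l T) x := by rw [free_bk]; exact h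
    have h2 := sig_spec hX h
    rw [bk_of_free _ _ _ _ _ h', free_bk, bk_of_free _ _ _ _ _ h2.1, h2.2.2, Equiv.swap_apply_self]
  · have h' : ¬ Free c j k l (bk hX j k l T) x := by rw [free_bk]; exact h
    rw [bk_of_not _ _ _ _ _ h', bk_of_not _ _ _ _ _ h]

lemma bk_right {x : X} (h : j ≤ c x) : bk hX j k l T x = T x :=
  bk_of_not hX j k l T fun hF => absurd hF.1 (not_lt.2 h)

variable {k l T}

lemma bk_sst (hkl : (l : ℕ) = k + 1) (hT : SST r c T)
    (hS : ∀ x y, T x = k → T y = k → r x = r y → c x < j → j ≤ c y → False) :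
    SST r c (bk hX j k l T) := by
  refine ⟨fun x y hr hc => ?_, fun x y hc hr => ?_⟩
  · rcases eq_or_lt_of_le hc with hc | hc
    · rw [hX.inj x y hr hc]
    have hxy := hT.row x y hr hc.le
    by_cases hx : Free c j k l T x <;> by_cases hy : Free c j k l T y
    · have h1 := bk_free hX j k l T hx
      have h2 := bk_free hX j k l T hy
      have h3 := sig_anti hX hx hy hr hc
      have h4 := hT.row (sig hX (Free c j k l T) y) (sig hX (Free c j k l T) x)
        (by rw [(sig_spec hX hx).2.1, (sig_spec hX hy).2.1, hr]) h3.le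
      rcases h1 with ⟨a1, a2⟩ | ⟨a1, a2⟩ <;> rcases h2 with ⟨b1, b2⟩ | ⟨b1, b2⟩ <;>
        rw [a2, b2] <;> rw [a1, b1] at h4 <;> rw [Fin.le_def] at * <;> omega
    · rw [bk_of_not hX j k l T hy]
      have hne : T y ≠ k := by
        intro hyk
        have hxk : T x = k := by
          rcases hx.2.1 with h | h
          · exact h
          · rw [h, hyk, Fin.le_def] at hxy; omega
        by_cases hj : j ≤ c y
        · exact hS x y hxk hyk hr hx.1 hj
        · have : ∃ z, c z = c y ∧ (T z = k ∨ T z = l) ∧ z ≠ y := by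
            by_contra hcon
            push Not at hcon
            exact hy ⟨by omega, Or.inl hyk, hcon⟩
          obtain ⟨z, hz1, hz2, hz3⟩ := this
          have hzl : T z = l := by
            rcases hz2 with h | h
            · exact absurd (hT.eq_of_col hX (h.trans hyk.symm) hz1) hz3
            · exact h
          have hrz : r y < r z := by
            rcases lt_trichotomy (r y) (r z) with h | h | h
            · exact h
            · exact absurd (hX.inj z y h.symm hz1) hz3
            · have := hT.col z y hz1 h
              rw [hzl, hyk, Fin.lt_def] at this; omega
          obtain ⟨w, hw1, hw2⟩ := hX.corner₂ x z (by omega) (by omega)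
          have a1 := hT.col x w hw2.symm (by omega)
          have a2 := hT.row w z hw1 (by omega)
          have hwl : T w = l := by
            apply Fin.ext
            rw [hxk, Fin.lt_def] at a1
            rw [hzl, Fin.le_def] at a2
            omega
          have := hx.2.2 w hw2 (Or.inr hwl)
          rw [this, hxk] at hwl
          rw [← hwl] at hkl; omega
      have h1 := bk_free hX j k l T hx
      have h2 : (k : ℕ) ≤ T y := by
        have := hx.2.1
        rw [Fin.le_def] at hxy
        rcases this with h | h <;> rw [h] at hxy <;> omega
      have h3 : (T y : ℕ) ≠ k := fun h => hne (Fin.ext h)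
      rw [Fin.le_def]
      rcases h1 with ⟨_, a2⟩ | ⟨_, a2⟩ <;> rw [a2] <;> omega
    · rw [bk_of_not hX j k l T hx]
      have hne : T x ≠ l := by
        intro hxl
        have hyl : T y = l := by
          rcases hy.2.1 with h | h
          · rw [h, hxl, Fin.le_def] at hxy; omega
          · exact h
        have hyj := hy.1
        have : ∃ z, c z = c x ∧ (T z = k ∨ T z = l) ∧ z ≠ x := by
          by_contra hcon
          push Not at hcon
          exact hx ⟨by omega, Or.inr hxl, hcon⟩
        obtain ⟨z, hz1, hz2, hz3⟩ := this
        have hzk : T z = k := by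
          rcases hz2 with h | h
          · exact h
          · exact absurd (hT.eq_of_col hX (h.trans hxl.symm) hz1) hz3
        have hrz : r z < r x := by
          rcases lt_trichotomy (r z) (r x) with h | h | h
          · exact h
          · exact absurd (hX.inj z x h hz1) hz3
          · have := hT.col x z hz1.symm h
            rw [hxl, hzk, Fin.lt_def] at this; omega
        obtain ⟨w, hw1, hw2⟩ := hX.corner₁ z y (by omega) (by omega)
        have a1 := hT.col w y hw2 (by omega)
        have a2 := hT.row z w hw1.symm (by omega)
        have hwk : T w = k := by
          apply Fin.ext
          rw [hyl, Fin.lt_def] at a1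
          rw [hzk, Fin.le_def] at a2
          omega
        have := hy.2.2 w hw2 (Or.inl hwk)
        rw [this, hyl] at hwk
        rw [← hwk] at hkl; omega
      have h1 := bk_free hX j k l T hy
      have h2 : (T x : ℕ) ≤ l := by
        have := hy.2.1
        rw [Fin.le_def] at hxy
        rcases this with h | h <;> rw [h] at hxy <;> omega
      have h3 : (T x : ℕ) ≠ l := fun h => hne (Fin.ext h)
      rw [Fin.le_def]
      rcases h1 with ⟨_, a2⟩ | ⟨_, a2⟩ <;> rw [a2] <;> omega
    · rw [bk_of_not hX j k l T hx, bk_of_not hX j k l T hy]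
      exact hxy
  · have hxy := hT.col x y hc hr
    by_cases hx : Free c j k l T x <;> by_cases hy : Free c j k l T y
    · have := hx.2.2 y hc.symm hy.2.1
      rw [this] at hr; omega
    · rw [bk_of_not hX j k l T hy]
      have h1 : T y ≠ l := by
        intro h
        have := hx.2.2 y hc.symm (Or.inr h)
        rw [this] at hr; omega
      have h1' : (T y : ℕ) ≠ l := fun h => h1 (Fin.ext h)
      have h2 : (k : ℕ) < T y := by
        rw [Fin.lt_def] at hxy
        rcases hx.2.1 with h | h <;> rw [h] at hxy <;> omega
      rw [Fin.lt_def]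
      rcases bk_free hX j k l T hx with ⟨_, a2⟩ | ⟨_, a2⟩ <;> rw [a2] <;> omega
    · rw [bk_of_not hX j k l T hx]
      have h1 : T x ≠ k := by
        intro h
        have := hy.2.2 x hc (Or.inl h)
        rw [this] at hr; omega
      have h1' : (T x : ℕ) ≠ k := fun h => h1 (Fin.ext h)
      have h2 : (T x : ℕ) < l := by
        rw [Fin.lt_def] at hxy
        rcases hy.2.1 with h | h <;> rw [h] at hxy <;> omega
      rw [Fin.lt_def]
      rcases bk_free hX j k l T hy with ⟨_, a2⟩ | ⟨_, a2⟩ <;> rw [a2] <;> omega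
    · rw [bk_of_not hX j k l T hx, bk_of_not hX j k l T hy]
      exact hxy

lemma bk_cnt_le (hT : SST r c T) (a : Fin n) :
    cnt (fun x => bk hX j k l T x = a ∧ c x < j) ≤
      cnt (fun x => T x = Equiv.swap k l a ∧ c x < j) := by
  apply cnt_le_exists (fun x z => (Free c j k l T x ∧ z = sig hX (Free c j k l T) x) ∨
    (¬ Free c j k l T x ∧ ¬ Free c j k l T z ∧ c x = c z))
  · rintro x ⟨hx, hj⟩
    by_cases hF : Free c j k l T x
    · refine ⟨_, ⟨?_, (sig_spec hX hF).1.1⟩, Or.inl ⟨hF, rfl⟩⟩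
      rw [← hx]
      unfold bk
      rw [if_pos hF, Equiv.swap_apply_self]
    · rw [bk_of_not hX j k l T hF] at hx
      by_cases ha : a = k ∨ a = l
      · have : ∃ z, c z = c x ∧ (T z = k ∨ T z = l) ∧ z ≠ x := by
          by_contra hcon
          push Not at hcon
          exact hF ⟨hj, by rw [hx]; exact ha, hcon⟩
        obtain ⟨z, hz1, hz2, hz3⟩ := this
        have hne : T z ≠ T x := fun h => hz3 (hT.eq_of_col hX h hz1)
        refine ⟨z, ⟨?_, by omega⟩, Or.inr ⟨hF, ?_, hz1.symm⟩⟩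
        · rw [hx] at hne
          rcases ha with rfl | rfl <;> rcases hz2 with h | h <;> simp_all
        · intro hFz
          exact hz3 (hFz.2.2 x hz1.symm (by rw [hx]; exact ha)).symm
      · push Not at ha
        refine ⟨x, ⟨?_, hj⟩, Or.inr ⟨hF, hF, rfl⟩⟩
        rw [hx, Equiv.swap_apply_of_ne_of_ne ha.1 ha.2]
  · rintro x y z ⟨hx, _⟩ ⟨hy, _⟩ (⟨h1, h2⟩ | ⟨h1, h2, h3⟩) (⟨h4, h5⟩ | ⟨h4, h5, h6⟩)
    · rw [← (sig_spec hX h1).2.2, ← h2, h5, (sig_spec hX h4).2.2]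
    · exact absurd (by rw [h2]; exact (sig_spec hX h1).1) h5
    · exact absurd (by rw [h5]; exact (sig_spec hX h4).1) h2
    · rw [bk_of_not hX j k l T h1] at hx
      rw [bk_of_not hX j k l T h4] at hy
      exact hT.eq_of_col hX (hx.trans hy.symm) (h3.trans h6.symm)

lemma bk_cnt (hT : SST r c T) (hT' : SST r c (bk hX j k l T)) (a : Fin n) :
    cnt (fun x => bk hX j k l T x = a ∧ c x < j) =
      cnt (fun x => T x = Equiv.swap k l a ∧ c x < j) := by
  apply le_antisymm (bk_cnt_le hX j hT a)
  have := bk_cnt_le hX j (k := k) (l := l) hT' (Equiv.swap k l a)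
  rw [bk_bk, Equiv.swap_apply_self] at this
  exact this

end BK
/-! ### Signed counting -/

section signed
variable {n : ℕ}

/-- The signed indicator of the dot-orbit of `nu`. -/
noncomputable def sgnF (nu al : Fin n → ℕ) : ℤ :=
  (Matrix.of fun i j : Fin n => if al i + (n - i) = nu j + (n - j) then (1 : ℤ) else 0).det

lemma sgnF_anti (nu al be : Fin n → ℕ) (k l : Fin n) (hkl : k ≠ l)
    (hk : be k + (n - k) = al l + (n - l)) (hl : be l + (n - l) = al k + (n - k))
    (ho : ∀ a, a ≠ k → a ≠ l → be a = al a) : sgnF nu be = - sgnF nu al := by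
  unfold sgnF
  have : (Matrix.of fun i j : Fin n => if be i + (n - i) = nu j + (n - j) then (1 : ℤ) else 0) =
      (Matrix.of fun i j : Fin n => if al i + (n - i) = nu j + (n - j) then (1 : ℤ) else 0).submatrix
        (Equiv.swap k l) id := by
    ext i j
    simp only [Matrix.of_apply, Matrix.submatrix_apply, id]
    by_cases h1 : i = k
    · subst h1; rw [Equiv.swap_apply_left, hk]
    · by_cases h2 : i = l
      · subst h2; rw [Equiv.swap_apply_right, hl]
      · rw [Equiv.swap_apply_of_ne_of_ne h1 h2, ho i h1 h2]
  rw [this, Matrix.det_permute, Equiv.Perm.sign_swap hkl]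
  simp

lemma strictAnti_shift {al : Fin n → ℕ} (h : Antitone al) :
    StrictAnti fun i : Fin n => al i + (n - i) := by
  intro i j hij
  have := h hij.le
  have hi := i.2
  have hj := j.2
  rw [Fin.lt_def] at hij
  simp only
  omega

lemma sgnF_dominant (nu al : Fin n → ℕ) (hnu : Antitone nu) (hal : Antitone al) :
    sgnF nu al = if al = nu then 1 else 0 := by
  have h1 := strictAnti_shift hnu
  have h2 := strictAnti_shift hal
  split_ifs with h
  · subst h
    unfold sgnF
    rw [← Matrix.det_one (n := Fin n)]
    congr 1
    ext i j
    rw [Matrix.one_apply, Matrix.of_apply]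
    by_cases hij : i = j
    · simp [hij]
    · rw [if_neg hij, if_neg]
      exact fun h => hij (h1.injective h)
  · unfold sgnF
    rw [Matrix.det_apply]
    apply Finset.sum_eq_zero
    intro σ _
    have : ∃ i, ¬ (al (σ i) + (n - (σ i)) = nu i + (n - i)) := by
      by_contra hcon
      push Not at hcon
      have hσ : StrictMono σ := by
        intro i j hij
        have := h1 hij
        simp only at this
        rw [← hcon, ← hcon] at this
        exact h2.lt_iff_gt.1 this
      have hid : ∀ i, σ i = i := by
        intro i
        let e : Fin n ≃o Fin n := hσ.orderIsoOfSurjective _ σ.surjective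
        have : e = OrderIso.refl _ := Subsingleton.elim _ _
        exact congrArg (fun f : Fin n ≃o Fin n => f i) this
      apply h
      funext i
      have := hcon i
      rw [hid] at this
      omega
    obtain ⟨i, hi⟩ := this
    rw [Finset.prod_eq_zero (Finset.mem_univ i), smul_zero]
    rw [Matrix.of_apply, if_neg hi]

end signed

section stembridge
variable {X : Type} [Fintype X] {r c : X → ℤ} {n : ℕ}

/-- content of a filling -/
noncomputable def wt (T : X → Fin n) : Fin n → ℕ := fun a => cnt (fun x => T x = a)

/-- `(j, k, l)` is the first violation of the column lattice condition -/
def FirstBad (c : X → ℤ) (T : X → Fin n) (p : ℤ × Fin n × Fin n) : Prop :=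
  (p.2.2 : ℕ) = p.2.1 + 1 ∧
  cnt (fun x => T x = p.2.1 ∧ p.1 ≤ c x) < cnt (fun x => T x = p.2.2 ∧ p.1 ≤ c x) ∧
  (∀ j, p.1 < j → ∀ k l : Fin n, (l : ℕ) = k + 1 →
    cnt (fun x => T x = l ∧ j ≤ c x) ≤ cnt (fun x => T x = k ∧ j ≤ c x)) ∧
  (∀ k l : Fin n, (l : ℕ) = k + 1 → k < p.2.1 →
    cnt (fun x => T x = l ∧ p.1 ≤ c x) ≤ cnt (fun x => T x = k ∧ p.1 ≤ c x))

lemma firstBad_exists {T : X → Fin n} (h : ¬ Good c T) : ∃ p, FirstBad c T p := by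
  unfold Good at h
  push Not at h
  have hb : ∃ b : ℤ, ∀ j : ℤ, (∃ k l : Fin n, (l : ℕ) = k + 1 ∧
      cnt (fun x => T x = k ∧ j ≤ c x) < cnt (fun x => T x = l ∧ j ≤ c x)) → j ≤ b := by
    obtain ⟨j0, k0, l0, _, h0⟩ := h
    obtain ⟨x0, _⟩ := exists_of_cnt_pos (lt_of_le_of_lt (Nat.zero_le _) h0)
    obtain ⟨b, -, hb⟩ := exists_min_of (P := fun _ : X => True) (fun x => - c x) ⟨x0, trivial⟩
    refine ⟨c b, ?_⟩
    rintro j ⟨k, l, _, hkl⟩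
    obtain ⟨x, hx⟩ := exists_of_cnt_pos (lt_of_le_of_lt (Nat.zero_le _) hkl)
    have := hb x trivial
    omega
  obtain ⟨j, ⟨k0, l0, hkl0, hlt0⟩, hmax⟩ := Int.exists_greatest_of_bdd hb h
  obtain ⟨k, ⟨l, hkl, hlt⟩, hmin⟩ := WellFounded.has_min (wellFounded_lt (α := Fin n))
    {k : Fin n | ∃ l : Fin n, (l : ℕ) = k + 1 ∧
      cnt (fun x => T x = k ∧ j ≤ c x) < cnt (fun x => T x = l ∧ j ≤ c x)} ⟨k0, l0, hkl0, hlt0⟩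
  refine ⟨(j, k, l), hkl, hlt, ?_, ?_⟩
  · intro j' hj' k' l' hkl'
    by_contra hcon
    have := hmax j' ⟨k', l', hkl', not_le.1 hcon⟩
    simp only at hj'
    omega
  · intro k' l' hkl' hk'
    by_contra hcon
    exact hmin k' ⟨l', hkl', not_le.1 hcon⟩ hk'

lemma firstBad_unique {T : X → Fin n} {p q : ℤ × Fin n × Fin n} (hp : FirstBad c T p)
    (hq : FirstBad c T q) : p = q := by
  obtain ⟨j, k, l⟩ := p
  obtain ⟨j', k', l'⟩ := q
  obtain ⟨a1, a2, a3, a4⟩ := hp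
  obtain ⟨b1, b2, b3, b4⟩ := hq
  simp only at a1 a2 a3 a4 b1 b2 b3 b4
  have hj : j = j' := by
    rcases lt_trichotomy j j' with h | h | h
    · have := a3 j' h k' l' b1; omega
    · exact h
    · have := b3 j h k l a1; omega
  subst hj
  have hk : k = k' := by
    rcases lt_trichotomy k k' with h | h | h
    · have := b4 k l a1 h; omega
    · exact h
    · have := a4 k' l' b1 h; omega
  subst hk
  have : l = l' := Fin.ext (by omega)
  rw [this]

lemma firstBad_congr {T T' : X → Fin n} {p : ℤ × Fin n × Fin n} (hp : FirstBad c T p)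
    (h : ∀ x, p.1 ≤ c x → T' x = T x) : FirstBad c T' p := by
  have key : ∀ j, p.1 ≤ j → ∀ a, cnt (fun x => T' x = a ∧ j ≤ c x) = cnt (fun x => T x = a ∧ j ≤ c x) := by
    intro j hj a
    apply cnt_congr
    intro x
    constructor
    · rintro ⟨h1, h2⟩; exact ⟨by rw [← h x (hj.trans h2)]; exact h1, h2⟩
    · rintro ⟨h1, h2⟩; exact ⟨by rw [h x (hj.trans h2)]; exact h1, h2⟩
  obtain ⟨a1, a2, a3, a4⟩ := hp
  refine ⟨a1, ?_, ?_, ?_⟩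
  · rw [key _ le_rfl, key _ le_rfl]; exact a2
  · intro j hj k l hkl
    rw [key _ hj.le, key _ hj.le]; exact a3 j hj k l hkl
  · intro k l hkl hk
    rw [key _ le_rfl, key _ le_rfl]; exact a4 k l hkl hk

lemma firstBad_col (hX : Skew r c) {T : X → Fin n} (hT : SST r c T) {j : ℤ} {k l : Fin n}
    (hp : FirstBad c T (j, k, l)) :
    cnt (fun x => T x = l ∧ j ≤ c x) = cnt (fun x => T x = k ∧ j ≤ c x) + 1 ∧
    (∃ w, T w = l ∧ c w = j) ∧ ∀ x, T x = k → c x ≠ j := by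
  obtain ⟨a1, a2, a3, -⟩ := hp
  simp only at a1 a2 a3
  have h1 := a3 (j + 1) (by omega) k l a1
  have split : ∀ a, cnt (fun x => T x = a ∧ j ≤ c x) =
      cnt (fun x => T x = a ∧ j + 1 ≤ c x) + cnt (fun x => T x = a ∧ c x = j) := by
    intro a
    rw [cnt_split (fun x => T x = a ∧ j ≤ c x) (fun x => j + 1 ≤ c x)]
    congr 1
    · exact cnt_congr fun x => ⟨fun h => ⟨h.1.1, h.2⟩, fun h => ⟨⟨h.1, by omega⟩, h.2⟩⟩
    · exact cnt_congr fun x => ⟨fun h => ⟨h.1.1, by omega⟩, fun h => ⟨⟨h.1, by omega⟩, by omega⟩⟩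
  have hle : ∀ a, cnt (fun x => T x = a ∧ c x = j) ≤ 1 := fun a => cnt_le_one
    fun x y hx hy => hT.eq_of_col hX (hx.1.trans hy.1.symm) (hx.2.trans hy.2.symm)
  have s1 := split k
  have s2 := split l
  have l2 := hle l
  refine ⟨by omega, ?_, ?_⟩
  · exact exists_of_cnt_pos (P := fun w => T w = l ∧ c w = j) (by omega)
  · intro x hx hxj
    have : cnt (fun _ : X => False) < cnt (fun x => T x = k ∧ c x = j) :=
      cnt_lt (fun _ h => h.elim) x ⟨hx, hxj⟩ (fun h => h)
    omega

lemma firstBad_sst (hX : Skew r c) {T : X → Fin n} (hT : SST r c T) {j : ℤ} {k l : Fin n}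
    (hp : FirstBad c T (j, k, l)) : SST r c (bk hX j k l T) := by
  obtain ⟨-, ⟨w, hw, hwj⟩, hk⟩ := firstBad_col hX hT hp
  have hkl : (l : ℕ) = k + 1 := hp.1
  apply bk_sst hX j hkl hT
  intro x y hx hy hr hxj hyj
  have hyj' := hk y hy
  by_cases h : r w ≤ r y
  · have := hT.mono hX h (by omega)
    rw [hw, hy, Fin.le_def] at this
    omega
  · obtain ⟨z, hz1, hz2⟩ := hX.corner₁ x w (by omega) (by omega)
    have a1 := hT.row x z hz1.symm (by omega)
    have a2 := hT.row z y (by omega) (by omega)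
    rw [hx] at a1
    rw [hy] at a2
    exact hk z (le_antisymm a2 a1) (by omega)

lemma wt_split (T : X → Fin n) (j : ℤ) (a : Fin n) :
    wt T a = cnt (fun x => T x = a ∧ j ≤ c x) + cnt (fun x => T x = a ∧ c x < j) := by
  unfold wt
  rw [cnt_split (fun x => T x = a) (fun x => j ≤ c x)]
  congr 1
  exact cnt_congr fun x => by rw [not_le]

lemma firstBad_sgn (hX : Skew r c) {T : X → Fin n} (hT : SST r c T) {j : ℤ} {k l : Fin n}
    (hp : FirstBad c T (j, k, l)) (nu : Fin n → ℕ) :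
    sgnF nu (wt (bk hX j k l T)) = - sgnF nu (wt T) := by
  have hkl : (l : ℕ) = k + 1 := hp.1
  have hT' := firstBad_sst hX hT hp
  obtain ⟨h1, -, -⟩ := firstBad_col hX hT hp
  have hR : ∀ a, cnt (fun x => bk hX j k l T x = a ∧ j ≤ c x) = cnt (fun x => T x = a ∧ j ≤ c x) := by
    intro a
    apply cnt_congr
    intro x
    constructor
    · rintro ⟨h1, h2⟩; exact ⟨by rw [← bk_right hX j k l T h2]; exact h1, h2⟩
    · rintro ⟨h1, h2⟩; exact ⟨by rw [bk_right hX j k l T h2]; exact h1, h2⟩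
  have hW : ∀ a, wt (bk hX j k l T) a = cnt (fun x => T x = a ∧ j ≤ c x) +
      cnt (fun x => T x = Equiv.swap k l a ∧ c x < j) := by
    intro a
    rw [wt_split (c := c) _ j, hR, bk_cnt hX j hT hT']
  have hk := hW k
  have hl := hW l
  rw [Equiv.swap_apply_left] at hk
  rw [Equiv.swap_apply_right] at hl
  have hk' := wt_split (c := c) T j k
  have hl' := wt_split (c := c) T j l
  have := l.2
  apply sgnF_anti nu _ _ k l (fun h => by rw [h] at hkl; omega)
  · omega
  · omega
  · intro a hak hal
    rw [hW a, Equiv.swap_apply_of_ne_of_ne hak hal, wt_split (c := c) T j a]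

lemma sum_bad (hX : Skew r c) (nu : Fin n → ℕ) :
    ∑ T ∈ Finset.univ.filter (fun T : X → Fin n => SST r c T ∧ ¬ Good c T), sgnF nu (wt T) = 0 := by
  classical
  have hex : ∀ T ∈ Finset.univ.filter (fun T : X → Fin n => SST r c T ∧ ¬ Good c T),
      ∃ p, FirstBad c T p := by
    intro T hT
    simp only [Finset.mem_filter, Finset.mem_univ, true_and] at hT
    exact firstBad_exists hT.2
  choose P hP using hex
  have hbad : ∀ (T : X → Fin n) p, FirstBad c T p → ¬ Good c T := by
    intro T p hp hg
    have := hg p.1 p.2.1 p.2.2 hp.1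
    have := hp.2.1
    omega
  have hsst : ∀ T ∈ Finset.univ.filter (fun T : X → Fin n => SST r c T ∧ ¬ Good c T), SST r c T := by
    intro T hT
    simp only [Finset.mem_filter, Finset.mem_univ, true_and] at hT
    exact hT.1
  have hFB : ∀ T hT, FirstBad c (bk hX (P T hT).1 (P T hT).2.1 (P T hT).2.2 T) (P T hT) :=
    fun T hT => firstBad_congr (hP T hT) fun x hx => bk_right hX _ _ _ _ hx
  have hadd : ∀ T hT, sgnF nu (wt T) +
      sgnF nu (wt (bk hX (P T hT).1 (P T hT).2.1 (P T hT).2.2 T)) = 0 := by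
    intro T hT
    rw [firstBad_sgn hX (hsst T hT) (hP T hT)]
    ring
  have hmem : ∀ T hT, bk hX (P T hT).1 (P T hT).2.1 (P T hT).2.2 T ∈
      Finset.univ.filter (fun T : X → Fin n => SST r c T ∧ ¬ Good c T) := by
    intro T hT
    simp only [Finset.mem_filter, Finset.mem_univ, true_and]
    exact ⟨firstBad_sst hX (hsst T hT) (hP T hT), hbad _ _ (hFB T hT)⟩
  refine Finset.sum_involution (fun T hT => bk hX (P T hT).1 (P T hT).2.1 (P T hT).2.2 T)
    hadd ?_ hmem ?_
  · intro T hT hne heq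
    have := hadd T hT
    rw [heq] at this
    omega
  · intro T hT
    have h := firstBad_unique (hP _ (hmem T hT)) (hFB T hT)
    rw [h, bk_bk]

lemma good_wt_antitone {T : X → Fin n} (hg : Good c T) : Antitone (wt T) := by
  have hj : ∃ j : ℤ, ∀ x, j ≤ c x := by
    by_cases h : ∃ _ : X, True
    · obtain ⟨b, -, hb⟩ := exists_min_of (P := fun _ : X => True) c (by simpa using h)
      exact ⟨c b, fun x => hb x trivial⟩
    · exact ⟨0, fun x => absurd ⟨x, trivial⟩ h⟩
  obtain ⟨j, hj⟩ := hj
  have hstep : ∀ k l : Fin n, (l : ℕ) = k + 1 → wt T l ≤ wt T k := by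
    intro k l hkl
    have := hg j k l hkl
    have e : ∀ a, wt T a = cnt (fun x => T x = a ∧ j ≤ c x) := fun a =>
      cnt_congr fun x => ⟨fun h => ⟨h, hj x⟩, fun h => h.1⟩
    rw [e, e]; exact this
  have : ∀ (d : ℕ) (a b : Fin n), (b : ℕ) = a + d → wt T b ≤ wt T a := by
    intro d
    induction d with
    | zero => intro a b h; rw [Fin.ext (show (b : ℕ) = a by omega)]
    | succ d ih =>
      intro a b h
      have hb := b.2
      exact (hstep ⟨a + d, by omega⟩ b (by simp only; omega)).trans (ih a ⟨a + d, by omega⟩ rfl)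
  intro a b hab
  rw [Fin.le_def] at hab
  exact this (b - a) a b (by omega)

/-- Stembridge form of the Littlewood–Richardson rule. -/
lemma stembridge (hX : Skew r c) (nu : Fin n → ℕ) (hnu : Antitone nu) :
    ∑ T ∈ Finset.univ.filter (fun T : X → Fin n => SST r c T), sgnF nu (wt T) =
      ({T : X → Fin n | GoodSST r c nu T}.ncard : ℤ) := by
  classical
  rw [← Finset.sum_filter_add_sum_filter_not _ (fun T : X → Fin n => Good c T),
    Finset.filter_filter, Finset.filter_filter]
  have h0 := sum_bad hX nu
  rw [show (∑ T ∈ Finset.univ.filter (fun T : X → Fin n => SST r c T ∧ ¬ Good c T),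
    sgnF nu (wt T)) = 0 from by convert h0, add_zero]
  have h1 : ∀ T ∈ Finset.univ.filter (fun T : X → Fin n => SST r c T ∧ Good c T),
      sgnF nu (wt T) = if wt T = nu then 1 else 0 := by
    intro T hT
    simp only [Finset.mem_filter, Finset.mem_univ, true_and] at hT
    exact sgnF_dominant nu _ hnu (good_wt_antitone hT.2)
  rw [Finset.sum_congr rfl h1, Finset.sum_boole, Finset.filter_filter]
  congr 1
  rw [← Set.ncard_coe_finset]
  congr 1
  ext T
  simp only [Finset.coe_filter, Finset.mem_univ, true_and, Set.mem_ofPred_eq]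
  constructor
  · rintro ⟨⟨a, b⟩, e⟩; exact ⟨a, b, fun i => congrFun e i⟩
  · rintro ⟨a, b, e⟩; exact ⟨⟨a, b⟩, funext e⟩

lemma sum_swap (hX : Skew r c) (k l : Fin n) (hkl : (l : ℕ) = k + 1) (G : (Fin n → ℕ) → ℤ) :
    ∑ T ∈ Finset.univ.filter (fun T : X → Fin n => SST r c T), G (wt T) =
    ∑ T ∈ Finset.univ.filter (fun T : X → Fin n => SST r c T), G (wt T ∘ Equiv.swap k l) := by
  classical
  have hj : ∃ j : ℤ, ∀ x, c x < j := by
    by_cases h : ∃ _ : X, True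
    · obtain ⟨b, -, hb⟩ := exists_min_of (P := fun _ : X => True) (fun x => - c x) (by simpa using h)
      exact ⟨c b + 1, fun x => by have := hb x trivial; omega⟩
    · exact ⟨0, fun x => absurd ⟨x, trivial⟩ h⟩
  obtain ⟨j, hj⟩ := hj
  have hs : ∀ T, SST r c T → SST r c (bk hX j k l T) := fun T hT =>
    bk_sst hX j hkl hT fun x y _ _ _ _ h => absurd (hj y) (not_lt.2 h)
  have hw : ∀ T, SST r c T → wt (bk hX j k l T) = wt T ∘ Equiv.swap k l := by
    intro T hT
    funext a
    have := bk_cnt hX j hT (hs T hT) a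
    have e : ∀ (T : X → Fin n) a, wt T a = cnt (fun x => T x = a ∧ c x < j) := fun T a =>
      cnt_congr fun x => ⟨fun h => ⟨h, hj x⟩, fun h => h.1⟩
    rw [Function.comp_apply, e, e, this]
  refine Finset.sum_bij' (fun T _ => bk hX j k l T) (fun T _ => bk hX j k l T) ?_ ?_ ?_ ?_ ?_
  · intro T hT
    simp only [Finset.mem_filter, Finset.mem_univ, true_and] at hT ⊢
    exact hs T hT
  · intro T hT
    simp only [Finset.mem_filter, Finset.mem_univ, true_and] at hT ⊢
    exact hs T hT
  · intro T _; exact bk_bk hX j k l T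
  · intro T _; exact bk_bk hX j k l T
  · intro T hT
    simp only [Finset.mem_filter, Finset.mem_univ, true_and] at hT
    rw [hw T hT]
    congr 1
    funext a
    simp

lemma sum_perm {m : ℕ} (hX : Skew r c) (π : Equiv.Perm (Fin (m + 1))) :
    ∀ (G : (Fin (m + 1) → ℕ) → ℤ),
    ∑ T ∈ Finset.univ.filter (fun T : X → Fin (m + 1) => SST r c T), G (wt T) =
    ∑ T ∈ Finset.univ.filter (fun T : X → Fin (m + 1) => SST r c T), G (wt T ∘ π) := by
  have hπ : π ∈ Submonoid.closure (Set.range fun i : Fin m => Equiv.swap i.castSucc i.succ) := by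
    rw [Equiv.Perm.mclosure_swap_castSucc_succ]; trivial
  induction hπ using Submonoid.closure_induction with
  | mem x h =>
    obtain ⟨i, rfl⟩ := h
    exact sum_swap hX _ _ (by simp)
  | one => intro G; rfl
  | mul x y _ _ hx hy =>
    intro G
    rw [hy G]
    exact hx (fun al => G (al ∘ y))

lemma Skew.neg (hX : Skew r c) : Skew (fun x => - r x) (fun x => - c x) where
  inj x y h1 h2 := hX.inj x y (by omega) (by omega)
  corner₁ x y h1 h2 := by
    obtain ⟨z, hz⟩ := hX.corner₁ y x (by omega) (by omega)
    obtain ⟨z, hz⟩ := hX.corner₂ y x (by omega) (by omega)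
    exact ⟨z, by omega, by omega⟩
  corner₂ x y h1 h2 := by
    obtain ⟨z, hz⟩ := hX.corner₁ y x (by omega) (by omega)
    exact ⟨z, by omega, by omega⟩

lemma SST.neg {T : X → Fin n} (hT : SST r c T) :
    SST (fun x => - r x) (fun x => - c x) (fun x => (T x).rev) where
  row x y h1 h2 := by
    rw [Fin.rev_le_rev]; exact hT.row y x (by omega) (by omega)
  col x y h1 h2 := by
    rw [Fin.rev_lt_rev]; exact hT.col y x (by omega) (by omega)

lemma wt_rev (T : X → Fin n) : wt (fun x => (T x).rev) = wt T ∘ Fin.revPerm := by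
  funext a
  exact cnt_congr fun x => by simp [Fin.rev_eq_iff]

lemma good_neg {m : ℕ} (hX : Skew r c) (nu : Fin (m + 1) → ℕ) (hnu : Antitone nu) :
    {T : X → Fin (m + 1) | GoodSST r c nu T}.ncard =
    {T : X → Fin (m + 1) | GoodSST (fun x => - r x) (fun x => - c x) nu T}.ncard := by
  classical
  have h1 := stembridge hX nu hnu
  have h2 := stembridge hX.neg nu hnu
  rw [← Nat.cast_inj (R := ℤ), ← h1, ← h2, sum_perm hX Fin.revPerm]
  refine Finset.sum_bij' (fun T _ => fun x => (T x).rev) (fun T _ => fun x => (T x).rev) ?_ ?_ ?_ ?_ ?_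
  · intro T hT
    simp only [Finset.mem_filter, Finset.mem_univ, true_and] at hT ⊢
    exact hT.neg
  · intro T hT
    simp only [Finset.mem_filter, Finset.mem_univ, true_and] at hT ⊢
    have := hT.neg
    simpa using this
  · intro T _; funext x; simp
  · intro T _; funext x; simp
  · intro T _; rw [wt_rev]

end stembridge

/-! ### Linking with the definition -/

section link
variable {X : Type} [Fintype X] {lam mu nu : YoungDiagram} {e : X → ℕ × ℕ}

lemma skew_of_emb (he : Function.Injective e) (hr : ∀ p, p ∈ skewCells lam mu ↔ ∃ x, e x = p) :
    Skew (fun x => ((e x).1 : ℤ)) (fun x => ((e x).2 : ℤ)) where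
  inj x y h1 h2 := he (Prod.ext (by exact_mod_cast h1) (by exact_mod_cast h2))
  corner₁ x y h1 h2 := by
    have hx := (hr (e x)).2 ⟨x, rfl⟩
    have hy := (hr (e y)).2 ⟨y, rfl⟩
    simp only [skewCells, Finset.mem_sdiff, YoungDiagram.mem_cells] at hx hy
    have h1' : (e x).1 ≤ (e y).1 := by exact_mod_cast h1
    have h2' : (e x).2 ≤ (e y).2 := by exact_mod_cast h2
    obtain ⟨z, hz⟩ := (hr ((e x).1, (e y).2)).1 (by
      simp only [skewCells, Finset.mem_sdiff, YoungDiagram.mem_cells]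
      exact ⟨lam.up_left_mem h1' le_rfl hy.1, fun h => hx.2 (mu.up_left_mem le_rfl h2' h)⟩)
    exact ⟨z, by simp [hz], by simp [hz]⟩
  corner₂ x y h1 h2 := by
    have hx := (hr (e x)).2 ⟨x, rfl⟩
    have hy := (hr (e y)).2 ⟨y, rfl⟩
    simp only [skewCells, Finset.mem_sdiff, YoungDiagram.mem_cells] at hx hy
    have h1' : (e x).1 ≤ (e y).1 := by exact_mod_cast h1
    have h2' : (e x).2 ≤ (e y).2 := by exact_mod_cast h2
    obtain ⟨z, hz⟩ := (hr ((e y).1, (e x).2)).1 (by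
      simp only [skewCells, Finset.mem_sdiff, YoungDiagram.mem_cells]
      exact ⟨lam.up_left_mem le_rfl h2' hy.1, fun h => hx.2 (mu.up_left_mem h1' le_rfl h)⟩)
    exact ⟨z, by simp [hz], by simp [hz]⟩

lemma card_filter_emb (he : Function.Injective e) (hr : ∀ p, p ∈ skewCells lam mu ↔ ∃ x, e x = p)
    (P : ℕ × ℕ → Prop) [DecidablePred P] :
    ((skewCells lam mu).filter P).card = cnt (fun x => P (e x)) := by
  symm
  apply Finset.card_nbij e
  · intro x hx
    simp only [Finset.coe_filter, Finset.mem_univ, true_and, Set.mem_ofPred_eq] at hx ⊢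
    exact ⟨(hr _).2 ⟨x, rfl⟩, hx⟩
  · exact he.injOn
  · intro p hp
    simp only [Finset.coe_filter, Set.mem_ofPred_eq] at hp
    obtain ⟨x, rfl⟩ := (hr p).1 hp.1
    exact ⟨x, by simpa using hp.2, rfl⟩

lemma prefixCount_emb (he : Function.Injective e) (hr : ∀ p, p ∈ skewCells lam mu ↔ ∃ x, e x = p)
    (T : ℕ × ℕ → ℕ) (i j k : ℕ) : prefixCount lam mu T i j k =
    cnt (fun x => T (e x) = k ∧ (((e x).1 : ℤ) < i ∨ (((e x).1 : ℤ) = i ∧ (j : ℤ) ≤ (e x).2))) := by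
  unfold prefixCount
  rw [card_filter_emb he hr]
  apply cnt_congr
  intro x
  rw [and_comm]
  norm_cast

lemma content_emb (he : Function.Injective e) (hr : ∀ p, p ∈ skewCells lam mu ↔ ∃ x, e x = p)
    (T : ℕ × ℕ → ℕ) (k : ℕ) : content lam mu T k = cnt (fun x => T (e x) = k) := by
  unfold content
  rw [card_filter_emb he hr]

lemma rowLen_zero {nu : YoungDiagram} {i : ℕ} (h : nu.colLen 0 ≤ i) : nu.rowLen i = 0 := by
  by_contra h0
  have : (i, 0) ∈ nu := YoungDiagram.mem_iff_lt_rowLen.2 (Nat.pos_of_ne_zero h0)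
  have := YoungDiagram.mem_iff_lt_colLen.1 this
  omega

/-- Translation between the frozen definition and abstract fillings. -/
lemma isLR_iff (he : Function.Injective e) (hr : ∀ p, p ∈ skewCells lam mu ↔ ∃ x, e x = p)
    {n : ℕ} (hn : nu.colLen 0 ≤ n) (S : X → Fin n) (T : ℕ × ℕ → ℕ)
    (hS : ∀ x, T (e x) = S x + 1) (h0 : ∀ p, p ∉ skewCells lam mu → T p = 0) :
    IsLR lam mu nu T ↔ GoodSST (fun x => ((e x).1 : ℤ)) (fun x => ((e x).2 : ℤ))
      (fun a : Fin n => nu.rowLen a) S := by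
  have hX := skew_of_emb he hr
  have hsst : IsSSYT lam mu T ↔ SST (fun x => ((e x).1 : ℤ)) (fun x => ((e x).2 : ℤ)) S := by
    constructor
    · rintro ⟨_, h1, h2⟩
      refine ⟨fun x y hr' hc => ?_, fun x y hc hr' => ?_⟩
      · have hr'' : (e x).1 = (e y).1 := by exact_mod_cast hr'
        have := h1 (e x).1 (e x).2 (e y).2 ((hr _).2 ⟨x, rfl⟩) ((hr _).2 ⟨y, by rw [hr'']⟩)
          (by exact_mod_cast hc)
        rw [show ((e x).1, (e y).2) = e y by rw [hr'']] at this
        rw [show ((e x).1, (e x).2) = e x from rfl, hS, hS] at this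
        rw [Fin.le_def]; omega
      · have hc' : (e x).2 = (e y).2 := by exact_mod_cast hc
        have := h2 (e x).1 (e y).1 (e x).2 ((hr _).2 ⟨x, rfl⟩) ((hr _).2 ⟨y, by rw [hc']⟩)
          (by exact_mod_cast hr')
        rw [show ((e y).1, (e x).2) = e y by rw [hc']] at this
        rw [show ((e x).1, (e x).2) = e x from rfl, hS, hS] at this
        rw [Fin.lt_def]; omega
    · intro h
      refine ⟨fun p => ⟨fun hp => ?_, fun hp => ?_⟩, ?_, ?_⟩
      · obtain ⟨x, rfl⟩ := (hr p).1 hp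
        rw [hS]; omega
      · by_contra hp'
        exact hp (h0 p hp')
      · intro i j1 j2 a1 a2 a3
        obtain ⟨x, hx⟩ := (hr _).1 a1
        obtain ⟨y, hy⟩ := (hr _).1 a2
        have := h.row x y (by simp [hx, hy]) (by simpa [hx, hy] using a3)
        rw [← hx, ← hy, hS, hS]
        rw [Fin.le_def] at this; omega
      · intro i1 i2 j a1 a2 a3
        obtain ⟨x, hx⟩ := (hr _).1 a1
        obtain ⟨y, hy⟩ := (hr _).1 a2
        have := h.col x y (by simp [hx, hy]) (by simpa [hx, hy] using a3)
        rw [← hx, ← hy, hS, hS]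
        rw [Fin.lt_def] at this; omega
  have hval : ∀ (x : X) (a : Fin n), T (e x) = a + 1 ↔ S x = a := by
    intro x a
    rw [hS, Fin.ext_iff]; omega
  have hlat : IsLattice lam mu T ↔ RowGood (fun x => ((e x).1 : ℤ)) (fun x => ((e x).2 : ℤ)) S := by
    unfold IsLattice RowGood
    simp only [prefixCount_emb he hr]
    constructor
    · intro h i j k l hkl
      by_cases hi : 0 ≤ i
      · have := h i.toNat j.toNat k
        have e1 : ∀ x, ((e x).1 < i.toNat ∨ (e x).1 = i.toNat ∧ j.toNat ≤ (e x).2) ↔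
            (((e x).1 : ℤ) < i ∨ ((e x).1 : ℤ) = i ∧ j ≤ ((e x).2 : ℤ)) := by
          intro x; omega
        convert! this using 2
        · funext x
          have := hval x l
          rw [hkl] at this
          rw [← this]
          have := e1 x
          apply propext
          apply and_congr Iff.rfl
          omega
        · funext x
          rw [← hval x k]
          apply propext
          apply and_congr Iff.rfl
          omega
      · rw [cnt_eq_zero]
        · exact Nat.zero_le _
        · rintro x ⟨_, h'⟩
          omega
    · intro h i j k
      by_cases hk : k + 1 < n
      · have := h i j ⟨k, by omega⟩ ⟨k + 1, hk⟩ rfl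
        convert! this using 2
        · funext x
          rw [← hval x]
        · funext x
          rw [← hval x]
      · rw [cnt_eq_zero]
        · exact Nat.zero_le _
        · rintro x ⟨h', _⟩
          rw [hS] at h'
          have := (S x).2
          omega
  have hcont : (∀ i, content lam mu T (i + 1) = nu.rowLen i) ↔
      ∀ a : Fin n, cnt (fun x => S x = a) = nu.rowLen a := by
    simp only [content_emb he hr]
    constructor
    · intro h a
      rw [← h a]
      exact cnt_congr fun x => (hval x a).symm
    · intro h i
      by_cases hi : i < n
      · rw [← h ⟨i, hi⟩]
        exact cnt_congr fun x => hval x ⟨i, hi⟩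
      · rw [rowLen_zero (by omega), cnt_eq_zero]
        intro x hx
        rw [hS] at hx
        have := (S x).2
        omega
  constructor
  · rintro ⟨a, b, d⟩
    have a' := hsst.1 a
    exact ⟨a', good_of_rowGood hX a' (hlat.1 b), hcont.1 d⟩
  · rintro ⟨a, b, d⟩
    exact ⟨hsst.2 a, hlat.2 (rowGood_of_good hX a b), hcont.2 d⟩

lemma lr_ncard (he : Function.Injective e) (hr : ∀ p, p ∈ skewCells lam mu ↔ ∃ x, e x = p)
    {n : ℕ} (hn : nu.colLen 0 ≤ n) :
    {S : X → Fin n | GoodSST (fun x => ((e x).1 : ℤ)) (fun x => ((e x).2 : ℤ))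
      (fun a : Fin n => nu.rowLen a) S}.ncard = {T : ℕ × ℕ → ℕ | IsLR lam mu nu T}.ncard := by
  classical
  let Φ : (X → Fin n) → ℕ × ℕ → ℕ := fun S p => if h : ∃ x, e x = p then (S h.choose : ℕ) + 1 else 0
  have hΦ : ∀ S x, Φ S (e x) = S x + 1 := by
    intro S x
    have h : ∃ y, e y = e x := ⟨x, rfl⟩
    simp only [Φ, dif_pos h]
    rw [he h.choose_spec]
  have hΦ0 : ∀ S p, p ∉ skewCells lam mu → Φ S p = 0 := by
    intro S p hp
    rw [hr] at hp
    simp only [Φ, dif_neg hp]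
  refine Set.ncard_congr (fun S _ => Φ S) ?_ ?_ ?_
  · intro S hS
    exact (isLR_iff he hr hn S (Φ S) (hΦ S) (hΦ0 S)).2 hS
  · intro S S' _ _ h
    funext x
    have := congrFun h (e x)
    simp only [hΦ] at this
    exact Fin.ext (by omega)
  · intro T hT
    have hT' : IsLR lam mu nu T := hT
    have hpos : ∀ x, T (e x) ≠ 0 := fun x => (hT'.1.1 _).1 ((hr _).2 ⟨x, rfl⟩)
    have hlt : ∀ x, T (e x) - 1 < n := by
      intro x
      by_contra hcon
      have h1 := hT'.2.2 (T (e x) - 1)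
      rw [rowLen_zero (by omega), content_emb he hr] at h1
      have : cnt (fun _ : X => False) < cnt (fun y => T (e y) = T (e x) - 1 + 1) :=
        cnt_lt (fun _ h => h.elim) x (by have := hpos x; omega) (fun h => h)
      omega
    have h0 : ∀ p, p ∉ skewCells lam mu → T p = 0 := by
      intro p hp
      by_contra h
      exact hp ((hT'.1.1 p).2 h)
    have hS : ∀ x, T (e x) = ((⟨T (e x) - 1, hlt x⟩ : Fin n) : ℕ) + 1 := by
      intro x; have := hpos x; simp only; omega
    refine ⟨fun x => ⟨T (e x) - 1, hlt x⟩, (isLR_iff he hr hn _ T hS h0).1 hT', ?_⟩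
    funext p
    by_cases hp : p ∈ skewCells lam mu
    · obtain ⟨x, rfl⟩ := (hr p).1 hp
      exact (hΦ (fun x => ⟨T (e x) - 1, hlt x⟩) x).trans (hS x).symm
    · exact (hΦ0 (fun x => ⟨T (e x) - 1, hlt x⟩) p hp).trans (h0 p hp).symm

end link

/-- conjugation symmetry of LR coefficients. -/
theorem lrCoeff_transpose (lam mu nu : YoungDiagram) (hmu : mu ≤ lam) :
    lrCoeff lam.transpose mu.transpose nu.transpose = lrCoeff lam mu nu := by
  have hmu' : mu.transpose ≤ lam.transpose := YoungDiagram.transpose_le_iff.2 hmu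
  unfold lrCoeff
  rw [if_pos hmu, if_pos hmu']
  let X := {p // p ∈ skewCells lam mu}
  let e : X → ℕ × ℕ := fun x => x.1
  let e' : X → ℕ × ℕ := fun x => x.1.swap
  have he : Function.Injective e := Subtype.val_injective
  have he' : Function.Injective e' := fun x y h => Subtype.ext (Prod.swap_injective h)
  have hr : ∀ p, p ∈ skewCells lam mu ↔ ∃ x, e x = p := fun p =>
    ⟨fun h => ⟨⟨p, h⟩, rfl⟩, fun ⟨x, hx⟩ => hx ▸ x.2⟩
  have hr' : ∀ p, p ∈ skewCells lam.transpose mu.transpose ↔ ∃ x, e' x = p := by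
    intro p
    have : p ∈ skewCells lam.transpose mu.transpose ↔ p.swap ∈ skewCells lam mu := by
      simp [skewCells, YoungDiagram.mem_transpose]
    rw [this, hr]
    constructor
    · rintro ⟨x, hx⟩; exact ⟨x, by change (e x).swap = p; rw [hx, Prod.swap_swap]⟩
    · rintro ⟨x, hx⟩; exact ⟨x, by rw [← hx]; exact (Prod.swap_swap _).symm⟩
  have hX := skew_of_emb he hr
  have hX' := skew_of_emb he' hr'
  have anti : ∀ (nu : YoungDiagram) (n : ℕ), Antitone (fun a : Fin n => nu.rowLen a) :=
    fun nu n a b h => nu.rowLen_anti _ _ h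
  rw [← lr_ncard he hr (Nat.le_succ _), ← lr_ncard he' hr' (Nat.le_succ _),
    good_ncard_eq_pic hX (Nat.le_succ _), good_neg hX' _ (anti _ _),
    good_ncard_eq_pic hX'.neg (Nat.le_succ _), pic_dual_ncard]
  simp only [neg_neg, YoungDiagram.transpose_transpose]
  rfl

end LRSkew
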